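/- Let n ≥ 2, let X₁,…,Xₙ, Z₁,…,Zₙ, W₁,…,Wₙ be positive real numbers, and let σ : {1,…,n} → {+1,−1} be a choice of signs taking both values +1 and −1. Set Mᵢ = E(Zᵢ,Wᵢ)·T(Xᵢ) if σ(i)=+1 and Mᵢ = E(Zᵢ,Wᵢ)·T(Xᵢ)⁻¹ if σ(i)=−1. Then the characteristic polynomial of the product M₁·M₂·⋯·Mₙ has three distinct positive real roots; i.e. the product has three distinct positive real eigenvalues. -/

import Mathlib

open Matrix Polynomial

/-- The matrix `T(X)` with rows `(0,0,1)`, `(0,-1,-1)`, `(X, 1+X, 1)`. -/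
def Tmat (X : ℝ) : Matrix (Fin 3) (Fin 3) ℝ :=
  !![0, 0, 1; 0, -1, -1; X, 1 + X, 1]

/-- The matrix `E(Z,W)` with rows `(0,0,Z⁻¹)`, `(0,-1,0)`, `(W,0,0)`. -/
noncomputable def Emat (Z W : ℝ) : Matrix (Fin 3) (Fin 3) ℝ :=
  !![0, 0, Z⁻¹; 0, -1, 0; W, 0, 0]


/-- Second compound matrix. -/
def cmpd (A : Matrix (Fin 3) (Fin 3) ℝ) : Matrix (Fin 3) (Fin 3) ℝ :=
  !![A 0 0 * A 1 1 - A 0 1 * A 1 0, A 0 0 * A 1 2 - A 0 2 * A 1 0, A 0 1 * A 1 2 - A 0 2 * A 1 1;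
     A 0 0 * A 2 1 - A 0 1 * A 2 0, A 0 0 * A 2 2 - A 0 2 * A 2 0, A 0 1 * A 2 2 - A 0 2 * A 2 1;
     A 1 0 * A 2 1 - A 1 1 * A 2 0, A 1 0 * A 2 2 - A 1 2 * A 2 0, A 1 1 * A 2 2 - A 1 2 * A 2 1]

lemma cmpd_mul (A B : Matrix (Fin 3) (Fin 3) ℝ) : cmpd (A * B) = cmpd A * cmpd B := by
  ext i j
  fin_cases i <;> fin_cases j <;>
    simp [cmpd, Matrix.mul_apply, Fin.sum_univ_three] <;> ring

/-- Upper triangular with positive entries on and above the diagonal. -/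
def UpM (A : Matrix (Fin 3) (Fin 3) ℝ) : Prop :=
  ∀ i j, (j < i → A i j = 0) ∧ (i ≤ j → 0 < A i j)

/-- Lower triangular with positive entries on and below the diagonal. -/
def LowM (A : Matrix (Fin 3) (Fin 3) ℝ) : Prop :=
  ∀ i j, (i < j → A i j = 0) ∧ (j ≤ i → 0 < A i j)

/-- Entrywise positive. -/
def PosM (A : Matrix (Fin 3) (Fin 3) ℝ) : Prop := ∀ i j, 0 < A i j

lemma UpM.nonneg {A : Matrix (Fin 3) (Fin 3) ℝ} (h : UpM A) (i j : Fin 3) : 0 ≤ A i j := by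
  rcases lt_or_ge j i with hij | hij
  · exact ((h i j).1 hij).ge
  · exact ((h i j).2 hij).le

lemma LowM.nonneg {A : Matrix (Fin 3) (Fin 3) ℝ} (h : LowM A) (i j : Fin 3) : 0 ≤ A i j := by
  rcases lt_or_ge i j with hij | hij
  · exact ((h i j).1 hij).ge
  · exact ((h i j).2 hij).le

lemma PosM.nonneg {A : Matrix (Fin 3) (Fin 3) ℝ} (h : PosM A) (i j : Fin 3) : 0 ≤ A i j :=
  (h i j).le

lemma mul_entry_pos {A B : Matrix (Fin 3) (Fin 3) ℝ} (hA : ∀ i j, 0 ≤ A i j)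
    (hB : ∀ i j, 0 ≤ B i j) (i j k : Fin 3) (h1 : 0 < A i k) (h2 : 0 < B k j) :
    0 < (A * B) i j := by
  rw [Matrix.mul_apply]
  exact Finset.sum_pos' (fun l _ => mul_nonneg (hA i l) (hB l j))
    ⟨k, Finset.mem_univ k, mul_pos h1 h2⟩

lemma UpM.mul {A B : Matrix (Fin 3) (Fin 3) ℝ} (hA : UpM A) (hB : UpM B) : UpM (A * B) := by
  intro i j
  constructor
  · intro hij
    rw [Matrix.mul_apply]
    refine Finset.sum_eq_zero fun l _ => ?_
    rcases lt_or_ge l i with h | h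
    · rw [(hA i l).1 h, zero_mul]
    · rw [(hB l j).1 (lt_of_lt_of_le hij h), mul_zero]
  · intro hij
    exact mul_entry_pos hA.nonneg hB.nonneg i j i ((hA i i).2 le_rfl) ((hB i j).2 hij)

lemma LowM.mul {A B : Matrix (Fin 3) (Fin 3) ℝ} (hA : LowM A) (hB : LowM B) :
    LowM (A * B) := by
  intro i j
  constructor
  · intro hij
    rw [Matrix.mul_apply]
    refine Finset.sum_eq_zero fun l _ => ?_
    rcases lt_or_ge i l with h | h
    · rw [(hA i l).1 h, zero_mul]
    · rw [(hB l j).1 (lt_of_le_of_lt h hij), mul_zero]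
  · intro hij
    exact mul_entry_pos hA.nonneg hB.nonneg i j i ((hA i i).2 le_rfl) ((hB i j).2 hij)

lemma UpM.mul_low {A B : Matrix (Fin 3) (Fin 3) ℝ} (hA : UpM A) (hB : LowM B) :
    PosM (A * B) := fun i j =>
  mul_entry_pos hA.nonneg hB.nonneg i j 2 ((hA i 2).2 (Fin.le_last i)) ((hB 2 j).2 (Fin.le_last j))

lemma LowM.mul_up {A B : Matrix (Fin 3) (Fin 3) ℝ} (hA : LowM A) (hB : UpM B) :
    PosM (A * B) := fun i j =>
  mul_entry_pos hA.nonneg hB.nonneg i j 0 ((hA i 0).2 (Fin.zero_le i)) ((hB 0 j).2 (Fin.zero_le j))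

lemma UpM.mul_pos {A B : Matrix (Fin 3) (Fin 3) ℝ} (hA : UpM A) (hB : PosM B) :
    PosM (A * B) := fun i j =>
  mul_entry_pos hA.nonneg hB.nonneg i j i ((hA i i).2 le_rfl) (hB i j)

lemma LowM.mul_pos {A B : Matrix (Fin 3) (Fin 3) ℝ} (hA : LowM A) (hB : PosM B) :
    PosM (A * B) := fun i j =>
  mul_entry_pos hA.nonneg hB.nonneg i j i ((hA i i).2 le_rfl) (hB i j)

/-- A predicate for a matrix together with its second compound. -/
def Both (P : Matrix (Fin 3) (Fin 3) ℝ → Prop) (A : Matrix (Fin 3) (Fin 3) ℝ) : Prop :=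
  P A ∧ P (cmpd A) ∧ 0 < A.det

lemma Both.mul {P Q R : Matrix (Fin 3) (Fin 3) ℝ → Prop}
    (h : ∀ {A B}, P A → Q B → R (A * B)) {A B : Matrix (Fin 3) (Fin 3) ℝ}
    (hA : Both P A) (hB : Both Q B) : Both R (A * B) := by
  refine ⟨h hA.1 hB.1, ?_, ?_⟩
  · rw [cmpd_mul]; exact h hA.2.1 hB.2.1
  · rw [Matrix.det_mul]; exact _root_.mul_pos hA.2.2 hB.2.2

lemma up_ET (X Z W : ℝ) (hX : 0 < X) (hZ : 0 < Z) (hW : 0 < W) :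
    Both UpM (Emat Z W * Tmat X) := by
  have e : Emat Z W * Tmat X = !![Z⁻¹ * X, Z⁻¹ * (1 + X), Z⁻¹; 0, 1, 1; 0, 0, W] := by
    ext i j
    fin_cases i <;> fin_cases j <;>
      simp [Emat, Tmat, Matrix.mul_apply, Fin.sum_univ_three]
  rw [e]
  have hZ' : 0 < Z⁻¹ := inv_pos.2 hZ
  refine ⟨?_, ?_, ?_⟩
  · intro i j
    fin_cases i <;> fin_cases j <;> simp <;> positivity
  · have e2 : cmpd !![Z⁻¹ * X, Z⁻¹ * (1 + X), Z⁻¹; 0, 1, 1; 0, 0, W]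
        = !![Z⁻¹ * X, Z⁻¹ * X, Z⁻¹ * X; 0, Z⁻¹ * X * W, Z⁻¹ * (1 + X) * W; 0, 0, W] := by
      ext i j
      fin_cases i <;> fin_cases j <;> simp [cmpd]
      ring
    rw [e2]
    intro i j
    fin_cases i <;> fin_cases j <;> simp <;> positivity
  · rw [Matrix.det_fin_three]
    simp
    positivity

lemma low_ET (X Z W : ℝ) (hX : 0 < X) (hZ : 0 < Z) (hW : 0 < W) :
    Both LowM (Emat Z W * (Tmat X)⁻¹) := by
  have ei : (Tmat X)⁻¹ = !![1, (1 + X) * X⁻¹, X⁻¹; -1, -1, 0; 1, 0, 0] := by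
    apply Matrix.inv_eq_right_inv
    ext i j
    fin_cases i <;> fin_cases j <;>
      simp [Tmat, Matrix.mul_apply, Fin.sum_univ_three] <;> field_simp <;> ring
  have e : Emat Z W * (Tmat X)⁻¹
      = !![Z⁻¹, 0, 0; 1, 1, 0; W, W * ((1 + X) * X⁻¹), W * X⁻¹] := by
    rw [ei]
    ext i j
    fin_cases i <;> fin_cases j <;>
      simp [Emat, Matrix.mul_apply, Fin.sum_univ_three]
  rw [e]
  have hZ' : 0 < Z⁻¹ := inv_pos.2 hZ
  have hX' : 0 < X⁻¹ := inv_pos.2 hX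
  refine ⟨?_, ?_, ?_⟩
  · intro i j
    fin_cases i <;> fin_cases j <;> simp <;> positivity
  · have e2 : cmpd !![Z⁻¹, 0, 0; 1, 1, 0; W, W * ((1 + X) * X⁻¹), W * X⁻¹]
        = !![Z⁻¹, 0, 0; Z⁻¹ * (W * ((1 + X) * X⁻¹)), Z⁻¹ * (W * X⁻¹), 0;
            W * X⁻¹, W * X⁻¹, W * X⁻¹] := by
      ext i j
      fin_cases i <;> fin_cases j <;> simp [cmpd]
      field_simp
      ring
    rw [e2]
    intro i j
    fin_cases i <;> fin_cases j <;> simp <;> positivity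
  · rw [Matrix.det_fin_three]
    simp
    positivity

lemma prod_class : ∀ (n : ℕ) (M : Fin (n + 1) → Matrix (Fin 3) (Fin 3) ℝ)
    (σ : Fin (n + 1) → Bool), (∀ i, σ i = true → Both UpM (M i)) →
    (∀ i, σ i = false → Both LowM (M i)) →
    ((∀ i, σ i = true) ∧ Both UpM (List.ofFn M).prod) ∨
    ((∀ i, σ i = false) ∧ Both LowM (List.ofFn M).prod) ∨
    Both PosM (List.ofFn M).prod := by
  intro n
  induction n with
  | zero =>
    intro M σ h1 h2
    have e : (List.ofFn M).prod = M 0 := by simp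
    rw [e]
    cases h : σ 0
    · right; left
      exact ⟨fun i => by rw [Fin.fin_one_eq_zero i, h], h2 0 h⟩
    · left
      exact ⟨fun i => by rw [Fin.fin_one_eq_zero i, h], h1 0 h⟩
  | succ n ih =>
    intro M σ h1 h2
    have e : (List.ofFn M).prod = M 0 * (List.ofFn fun i : Fin (n + 1) => M i.succ).prod := by
      rw [List.ofFn_succ, List.prod_cons]
    rw [e]
    have := ih (fun i => M i.succ) (fun i => σ i.succ) (fun i => h1 i.succ) (fun i => h2 i.succ)
    cases h : σ 0
    · have h0 := h2 0 h
      rcases this with ⟨_, hp⟩ | ⟨ha, hp⟩ | hp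
      · exact Or.inr (Or.inr (Both.mul LowM.mul_up h0 hp))
      · exact Or.inr (Or.inl ⟨fun i => Fin.cases h ha i, Both.mul LowM.mul h0 hp⟩)
      · exact Or.inr (Or.inr (Both.mul LowM.mul_pos h0 hp))
    · have h0 := h1 0 h
      rcases this with ⟨ha, hp⟩ | ⟨_, hp⟩ | hp
      · exact Or.inl ⟨fun i => Fin.cases h ha i, Both.mul UpM.mul h0 hp⟩
      · exact Or.inr (Or.inr (Both.mul UpM.mul_low h0 hp))
      · exact Or.inr (Or.inr (Both.mul UpM.mul_pos h0 hp))

/-- A cubic with prescribed sign changes has three distinct positive roots. -/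
lemma cubic_roots (s b d u v : ℝ) (hd : 0 < d) (hu : 0 < u) (huv : u < v)
    (h1 : 0 < u ^ 3 - s * u ^ 2 + b * u - d) (h2 : v ^ 3 - s * v ^ 2 + b * v - d < 0) :
    ∃ x y z : ℝ, 0 < x ∧ x < y ∧ y < z ∧ s = x + y + z ∧ b = x * y + x * z + y * z ∧
      d = x * y * z := by
  set f : ℝ → ℝ := fun t => t ^ 3 - s * t ^ 2 + b * t - d with hf
  have hc : Continuous f := by fun_prop
  obtain ⟨x, hx, hx0⟩ := intermediate_value_Ioo hu.le hc.continuousOn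
    (show (0 : ℝ) ∈ Set.Ioo (f 0) (f u) from ⟨by simp [hf, hd], h1⟩)
  obtain ⟨y, hy, hy0⟩ := intermediate_value_Ioo' huv.le hc.continuousOn
    (show (0 : ℝ) ∈ Set.Ioo (f v) (f u) from ⟨h2, h1⟩)
  have hxy : x < y := hx.2.trans hy.1
  have hx1 : x ^ 3 - s * x ^ 2 + b * x - d = 0 := hx0
  have hy1 : y ^ 3 - s * y ^ 2 + b * y - d = 0 := hy0
  have hb : b = s * (x + y) - (x ^ 2 + x * y + y ^ 2) := by
    have : (x - y) * (b - (s * (x + y) - (x ^ 2 + x * y + y ^ 2))) = 0 := by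
      linear_combination hx1 - hy1
    rcases mul_eq_zero.1 this with h | h <;> linarith
  have hdd : d = x * y * (s - x - y) := by
    rw [hb] at hx1
    linear_combination -hx1
  have hv : (v - x) * (v - y) * (v - (s - x - y)) < 0 := by
    rw [hb, hdd] at h2
    linarith [h2, show v ^ 3 - s * v ^ 2 + (s * (x + y) - (x ^ 2 + x * y + y ^ 2)) * v
      - x * y * (s - x - y) = (v - x) * (v - y) * (v - (s - x - y)) by ring]
  have hpos : 0 < (v - x) * (v - y) :=
    mul_pos (by linarith [hy.2]) (by linarith [hy.2])
  have hz : v - (s - x - y) < 0 := by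
    by_contra hcon
    push Not at hcon
    exact absurd hv (not_lt.2 (mul_nonneg hpos.le hcon))
  refine ⟨x, y, s - x - y, hx.1, hxy, by linarith [hy.2], by ring, ?_, hdd⟩
  rw [hb]; ring

lemma charpoly_three (A : Matrix (Fin 3) (Fin 3) ℝ) (h : Both PosM A) :
    ∃ x y z : ℝ, 0 < x ∧ x < y ∧ y < z ∧ A.charpoly =
      (Polynomial.X - Polynomial.C x) * (Polynomial.X - Polynomial.C y) *
          (Polynomial.X - Polynomial.C z) := by
  obtain ⟨hp, hc, hdet⟩ := h
  have m1 := hc 0 0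
  have m2 := hc 0 2
  have m3 := hc 2 0
  simp [cmpd] at m1 m2 m3
  have p00 := hp 0 0
  have p01 := hp 0 1
  have p02 := hp 0 2
  have p10 := hp 1 0
  have p11 := hp 1 1
  have p12 := hp 1 2
  have p20 := hp 2 0
  have p21 := hp 2 1
  have p22 := hp 2 2
  have hch : A.charpoly = Polynomial.X ^ 3 - C (A 0 0 + A 1 1 + A 2 2) * Polynomial.X ^ 2
      + C (A 0 0 * A 1 1 - A 0 1 * A 1 0 + (A 0 0 * A 2 2 - A 0 2 * A 2 0)
        + (A 1 1 * A 2 2 - A 1 2 * A 2 1)) * Polynomial.X - C A.det := by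
    rw [Matrix.charpoly, Matrix.det_fin_three, Matrix.det_fin_three]
    simp [Matrix.charmatrix_apply]
    ring
  have hdet' := hdet
  rw [Matrix.det_fin_three] at hdet'
  have hbc : 0 < A 0 1 * A 1 0 := mul_pos p01 p10
  obtain ⟨q1, hq1⟩ : ∃ q, q = A 0 0 := ⟨_, rfl⟩
  obtain ⟨q2, hq2⟩ : ∃ q, q = A 1 1 := ⟨_, rfl⟩
  set D := (A 0 0 - A 1 1) ^ 2 + 4 * (A 0 1 * A 1 0) with hD
  have hDpos : 0 < D := by positivity
  have hr : 0 < √D := Real.sqrt_pos.2 hDpos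
  have hr2 : √D ^ 2 = D := Real.sq_sqrt hDpos.le
  have habs : |A 0 0 - A 1 1| < √D := by
    rw [← Real.sqrt_sq_eq_abs]
    exact Real.sqrt_lt_sqrt (sq_nonneg _) (by linarith)
  obtain ⟨ha1, ha2⟩ := abs_lt.1 habs
  have hs : √D < A 0 0 + A 1 1 := by
    rw [Real.sqrt_lt' (by linarith)]
    nlinarith
  set r := √D with hrdef
  clear_value r
  have key : ∀ t : ℝ, (t - A 0 0) * (t - A 1 1) = A 0 1 * A 1 0 →
      t ^ 3 - (A 0 0 + A 1 1 + A 2 2) * t ^ 2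
      + (A 0 0 * A 1 1 - A 0 1 * A 1 0 + (A 0 0 * A 2 2 - A 0 2 * A 2 0)
        + (A 1 1 * A 2 2 - A 1 2 * A 2 1)) * t - A.det
      = -(A 2 0 * A 0 2 * (t - A 1 1) + A 2 0 * A 0 1 * A 1 2 + A 2 1 * A 1 0 * A 0 2
          + A 2 1 * A 1 2 * (t - A 0 0)) := by
    intro t ht
    rw [Matrix.det_fin_three]
    linear_combination (t - A 2 2) * ht
  obtain ⟨x, y, z, hx, hxy, hyz, e1, e2, e3⟩ := cubic_roots (A 0 0 + A 1 1 + A 2 2)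
    (A 0 0 * A 1 1 - A 0 1 * A 1 0 + (A 0 0 * A 2 2 - A 0 2 * A 2 0)
        + (A 1 1 * A 2 2 - A 1 2 * A 2 1)) A.det ((A 0 0 + A 1 1 - r) / 2)
    ((A 0 0 + A 1 1 + r) / 2) hdet (by linarith) (by linarith)
    (by
      rw [key _ (by rw [hD] at hr2; linear_combination hr2 / 4)]
      obtain ⟨p, hpd⟩ : ∃ p, p = A 1 1 - (A 0 0 + A 1 1 - r) / 2 := ⟨_, rfl⟩
      obtain ⟨q, hqd⟩ : ∃ q, q = A 0 0 - (A 0 0 + A 1 1 - r) / 2 := ⟨_, rfl⟩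
      have hppos : 0 < p := by rw [hpd]; linarith
      have hpq : p * q = A 0 1 * A 1 0 := by
        rw [hpd, hqd]; rw [hD] at hr2; linear_combination hr2 / 4
      have hplt : p < A 1 1 := by rw [hpd]; linarith
      have f1 : 0 < A 0 1 * A 1 2 - A 0 2 * p := by nlinarith
      have f2 : 0 < A 1 0 * A 2 1 - A 2 0 * p := by nlinarith
      have hprod := mul_pos f1 f2
      refine pos_of_mul_pos_right (a := p) ?_ hppos.le
      have : p * -(A 2 0 * A 0 2 * ((A 0 0 + A 1 1 - r) / 2 - A 1 1) + A 2 0 * A 0 1 * A 1 2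
          + A 2 1 * A 1 0 * A 0 2 + A 2 1 * A 1 2 * ((A 0 0 + A 1 1 - r) / 2 - A 0 0))
          = (A 0 1 * A 1 2 - A 0 2 * p) * (A 1 0 * A 2 1 - A 2 0 * p) := by
        have t1 : (A 0 0 + A 1 1 - r) / 2 - A 1 1 = -p := by rw [hpd]; ring
        have t2 : (A 0 0 + A 1 1 - r) / 2 - A 0 0 = -q := by rw [hqd]; ring
        rw [t1, t2]
        linear_combination A 2 1 * A 1 2 * hpq
      rw [this]; exact hprod)
    (by
      rw [key _ (by rw [hD] at hr2; linear_combination hr2 / 4)]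
      have g1 : 0 < (A 0 0 + A 1 1 + r) / 2 - A 1 1 := by linarith
      have g2 : 0 < (A 0 0 + A 1 1 + r) / 2 - A 0 0 := by linarith
      rw [neg_lt_zero]
      positivity)
  refine ⟨x, y, z, hx, hxy, hyz, ?_⟩
  rw [hch, e1, e2, e3]
  simp only [map_add, map_mul]
  ring

/-- Let `n ≥ 2`, let `Xᵢ, Zᵢ, Wᵢ` be positive reals and let `σ` be a choice of signs taking
both values.  Set `Mᵢ = E(Zᵢ,Wᵢ)·T(Xᵢ)` if `σ i` and `Mᵢ = E(Zᵢ,Wᵢ)·T(Xᵢ)⁻¹` otherwise.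
Then the characteristic polynomial of `M₀ ⋯ M_{n-1}` has three distinct positive real
roots. -/
theorem prod_charpoly_three_distinct_positive_roots (n : ℕ) (hn : 2 ≤ n)
    (X Z W : Fin n → ℝ) (hX : ∀ i, 0 < X i) (hZ : ∀ i, 0 < Z i) (hW : ∀ i, 0 < W i)
    (σ : Fin n → Bool) (hσt : ∃ i, σ i = true) (hσf : ∃ i, σ i = false) :
    letI M : Fin n → Matrix (Fin 3) (Fin 3) ℝ :=
      fun i => if σ i then Emat (Z i) (W i) * Tmat (X i)
               else Emat (Z i) (W i) * (Tmat (X i))⁻¹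
    ∃ a b c : ℝ, 0 < a ∧ 0 < b ∧ 0 < c ∧ a ≠ b ∧ a ≠ c ∧ b ≠ c ∧
      (List.ofFn M).prod.charpoly =
        (Polynomial.X - Polynomial.C a) * (Polynomial.X - Polynomial.C b) *
          (Polynomial.X - Polynomial.C c) := by
  obtain ⟨m, rfl⟩ : ∃ m, n = m + 1 := ⟨n - 1, by omega⟩
  set M : Fin (m + 1) → Matrix (Fin 3) (Fin 3) ℝ :=
      fun i => if σ i then Emat (Z i) (W i) * Tmat (X i)
               else Emat (Z i) (W i) * (Tmat (X i))⁻¹ with hM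
  obtain ⟨i, hi⟩ := hσt
  obtain ⟨j, hj⟩ := hσf
  have hcl := prod_class m M σ
    (fun k hk => by
      have : M k = Emat (Z k) (W k) * Tmat (X k) := by simp [M, hk]
      rw [this]; exact up_ET _ _ _ (hX k) (hZ k) (hW k))
    (fun k hk => by
      have : M k = Emat (Z k) (W k) * (Tmat (X k))⁻¹ := by simp [M, hk]
      rw [this]; exact low_ET _ _ _ (hX k) (hZ k) (hW k))
  have hpos : Both PosM (List.ofFn M).prod := by
    rcases hcl with ⟨h, _⟩ | ⟨h, _⟩ | h
    · simp [h j] at hj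
    · simp [h i] at hi
    · exact h
  obtain ⟨x, y, z, hx, hxy, hyz, hch⟩ := charpoly_three _ hpos
  exact ⟨x, y, z, hx, hx.trans hxy, (hx.trans hxy).trans hyz, hxy.ne, (hxy.trans hyz).ne,
    hyz.ne, hch⟩
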